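/- Let f be an orientation preserving circle homeomorphism with a fixed point. Then f is strongly reversible in Homeo⁺(S¹) (i.e., there is an orientation preserving involution σ with σ f σ = f⁻¹) if and only if there exists an orientation preserving homeomorphism h of the circle with rotation number 1/2 such that Δ_f = −Δ_f ∘ h. -/

import Mathlib

noncomputable section

open scoped Classical

local instance : Fact ((0:ℝ) < 1) := ⟨zero_lt_one⟩

/-- The circle `S¹`, realised as `ℝ / ℤ`. -/
abbrev S1 := AddCircle (1 : ℝ)

/-- `F` is a (monotone, degree one) lift of the circle homeomorphism `f`. -/
def IsLiftOf (f : S1 ≃ₜ S1) (F : CircleDeg1Lift) : Prop :=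
  ∀ x : ℝ, f (x : S1) = ((F x : ℝ) : S1)

/-- A circle homeomorphism is orientation preserving iff it admits a monotone degree one lift. -/
def OrientationPreserving (f : S1 ≃ₜ S1) : Prop :=
  ∃ F : CircleDeg1Lift, IsLiftOf f F

/-- A circle homeomorphism is orientation reversing iff it admits a strictly decreasing
degree `-1` lift. -/
def OrientationReversing (f : S1 ≃ₜ S1) : Prop :=
  ∃ F : ℝ → ℝ, StrictAnti F ∧ (∀ x : ℝ, F (x + 1) = F x - 1) ∧
    ∀ x : ℝ, f (x : S1) = ((F x : ℝ) : S1)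

/-- `f` has (Poincaré) rotation number `r` (mod 1): some lift has translation number `r`. -/
def HasRotationNumber (f : S1 ≃ₜ S1) (r : ℝ) : Prop :=
  ∃ F : CircleDeg1Lift, IsLiftOf f F ∧ F.translationNumber = r

/-- An involution. -/
def IsInvolution (f : S1 ≃ₜ S1) : Prop := ∀ x, f (f x) = x

/-- The canonical representative of a point of the circle in `[0, 1)`. -/
def rep (x : S1) : ℝ := (AddCircle.equivIco 1 0 x : ℝ)

/-- The signature of a circle homeomorphism with respect to a lift `F`; when `F` is the
(unique) lift with a fixed point of an orientation preserving homeomorphism with a fixed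
point, this is the signature function `Δ_f : S¹ → {-1, 0, 1}`. -/
def signature (F : CircleDeg1Lift) (x : S1) : ℝ := Real.sign (F (rep x) - rep x)

/-- Strong reversibility in `Homeo⁺(S¹)`. -/
def StronglyReversiblePlus (f : S1 ≃ₜ S1) : Prop :=
  ∃ σ : S1 ≃ₜ S1, OrientationPreserving σ ∧ IsInvolution σ ∧ ∀ x, σ (f (σ x)) = f.symm x

/-- Strong reversibility in the full group `Homeo(S¹)`. -/
def StronglyReversible (f : S1 ≃ₜ S1) : Prop :=
  ∃ τ : S1 ≃ₜ S1, IsInvolution τ ∧ ∀ x, τ (f (τ x)) = f.symm x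

/-- On the component of a point moved forward in the complement of its fixed set, an increasing
homeomorphism of the line is conjugate to the unit translation. -/
theorem OrderIso.exists_strictMono_add_one_of_lt (F : ℝ ≃o ℝ) {c : ℝ} (hc : c < F c) :
    ∃ ψ : ℝ → ℝ, StrictMono ψ ∧ Set.range ψ = Set.ordConnectedComponent {x | F x ≠ x} c ∧
      ∀ t, ψ (t + 1) = F (ψ t) := by
  have hsucc : ∀ (n : ℤ) (x : ℝ), (F ^ (n + 1)) x = F ((F ^ n) x) := fun n x => by
    rw [add_comm, zpow_one_add]; rfl
  have hfix : ∀ (n : ℤ) {q : ℝ}, F q = q → (F ^ n) q = q := by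
    intro n q hq
    have : F ∈ MulAction.stabilizer (ℝ ≃o ℝ) q := hq
    exact (MulAction.stabilizer (ℝ ≃o ℝ) q).zpow_mem this n
  set a : ℤ → ℝ := fun n => (F ^ n) c with ha
  have hasucc : ∀ n, a (n + 1) = F (a n) := fun n => hsucc n c
  have ha0 : a 0 = c := by simp [ha]
  have hamono : StrictMono a := strictMono_int_of_lt_succ fun n => by
    rw [hasucc, ← hasucc n, ha]
    simp only
    rw [zpow_add_one]
    exact (F ^ n).strictMono hc
  have hstay : ∀ (n : ℤ) {q : ℝ}, F q = q → (c < q ↔ a n < q) := fun n q hq => by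
    conv_rhs => rw [← hfix n hq]
    exact (F ^ n).lt_iff_lt.symm
  have habove : ∀ x ∈ Set.ordConnectedComponent {x | F x ≠ x} c, ∃ n, x < a n := by
    intro x hx
    by_contra! hle
    have hb : BddAbove (Set.range a) := ⟨x, by rintro _ ⟨n, rfl⟩; exact hle n⟩
    have hcq : c ≤ ⨆ n, a n := ha0 ▸ le_ciSup hb 0
    refine hx (Set.Icc_subset_uIcc ⟨hcq, ciSup_le hle⟩) (le_antisymm ?_ ?_)
    · rw [← F.le_symm_apply]
      refine ciSup_le fun n => ?_
      rw [F.le_symm_apply, ← hasucc]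
      exact le_ciSup hb _
    · refine ciSup_le fun n => ?_
      rw [← sub_add_cancel n 1, hasucc]
      exact F.monotone (le_ciSup hb _)
  have hbelow : ∀ x ∈ Set.ordConnectedComponent {x | F x ≠ x} c, ∃ n, a n ≤ x := by
    intro x hx
    by_contra! hlt
    have hle : ∀ n, x ≤ a n := fun n => (hlt n).le
    have hb : BddBelow (Set.range a) := ⟨x, by rintro _ ⟨n, rfl⟩; exact hle n⟩
    have hcq : ⨅ n, a n ≤ c := ha0 ▸ ciInf_le hb 0
    refine hx (Set.Icc_subset_uIcc' ⟨le_ciInf hle, hcq⟩) (le_antisymm ?_ ?_)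
    · refine le_ciInf fun n => ?_
      rw [← sub_add_cancel n 1, hasucc]
      exact F.monotone (ciInf_le hb _)
    · rw [← F.symm_apply_le]
      refine le_ciInf fun n => ?_
      rw [F.symm_apply_le, ← hasucc]
      exact ciInf_le hb _
  have hd : 0 < F c - c := sub_pos.2 hc
  set ψ : ℝ → ℝ := fun t => (F ^ ⌊t⌋) (c + Int.fract t * (F c - c)) with hψ
  have hψge : ∀ t, a ⌊t⌋ ≤ ψ t := fun t =>
    (F ^ ⌊t⌋).monotone (le_add_of_nonneg_right (mul_nonneg (Int.fract_nonneg t) hd.le))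
  have hψlt : ∀ t, ψ t < a (⌊t⌋ + 1) := fun t => by
    simp only [ha, zpow_add_one]
    refine (F ^ ⌊t⌋).strictMono ?_
    change _ < F c
    nlinarith [Int.fract_lt_one t]
  refine ⟨ψ, ?_, ?_, ?_⟩
  · intro t u htu
    rcases (Int.floor_mono htu.le).eq_or_lt with h | h
    · simp only [hψ, ← h]
      refine (F ^ ⌊t⌋).strictMono ?_
      have : Int.fract t < Int.fract u := by simp only [Int.fract, ← h]; linarith
      nlinarith
    · exact (hψlt t).trans_le ((hamono.monotone (by lia)).trans (hψge u))
  · ext x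
    constructor
    · rintro ⟨t, rfl⟩ q hq hFq
      rcases Set.mem_uIcc.1 hq with ⟨h1, h2⟩ | ⟨h1, h2⟩
      · have : c < q := h1.lt_of_ne fun h => hc.ne' (h ▸ hFq)
        exact lt_irrefl _ ((hψlt t).trans (((hstay _ hFq).1 this).trans_le h2))
      · have := ((hstay ⌊t⌋ hFq).2).mt h2.not_gt
        have h3 : a ⌊t⌋ ≤ q := (hψge t).trans h1
        rcases h3.eq_or_lt with h3 | h3
        · have := hasucc ⌊t⌋
          rw [h3, hFq, ← h3] at this
          exact absurd (hamono.injective this) (by lia)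
        · exact this h3
    · intro hx
      obtain ⟨N, hN⟩ := habove x hx
      obtain ⟨n, hn, hmax⟩ := Int.exists_greatest_of_bdd (P := fun n => a n ≤ x)
        ⟨N, fun z hz => (hamono.lt_iff_lt.1 (hz.trans_lt hN)).le⟩ (hbelow x hx)
      have hn1 : x < a (n + 1) := by
        by_contra! h
        have := hmax _ h
        lia
      set y := (F ^ n).symm x with hy
      have hxy : (F ^ n) y = x := (F ^ n).apply_symm_apply x
      have hy0 : c ≤ y := by rw [hy, (F ^ n).le_symm_apply]; exact hn
      have hy1 : y < F c := by
        rw [hy, (F ^ n).symm_apply_lt]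
        simp only [ha, zpow_add_one] at hn1
        exact hn1
      have hf0 : 0 ≤ (y - c) / (F c - c) := div_nonneg (by linarith) hd.le
      have hf1 : (y - c) / (F c - c) < 1 := (div_lt_one hd).2 (by linarith)
      refine ⟨n + (y - c) / (F c - c), ?_⟩
      simp only [hψ, Int.floor_intCast_add, Int.fract_intCast_add, Int.fract_eq_self.2 ⟨hf0, hf1⟩,
        Int.floor_eq_zero_iff.2 ⟨hf0, hf1⟩, add_zero]
      rw [div_mul_cancel₀ _ hd.ne', add_sub_cancel, hxy]
  · intro t
    simp only [hψ, Int.floor_add_one, Int.fract_add_one, hsucc]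

/-- On each component of the complement of its fixed set, an increasing homeomorphism of the line
is conjugate to a unit translation in the direction given by the signature. -/
theorem OrderIso.exists_strictMono_add_sign (F : ℝ ≃o ℝ) {c : ℝ} (hc : F c ≠ c) :
    ∃ ψ : ℝ → ℝ, StrictMono ψ ∧ Set.range ψ = Set.ordConnectedComponent {x | F x ≠ x} c ∧
      ∀ t, ψ (t + Real.sign (F c - c)) = F (ψ t) := by
  rcases hc.lt_or_gt with h | h
  · obtain ⟨ψ, hψ, hr, ha⟩ := F.symm.exists_strictMono_add_one_of_lt (F.lt_symm_apply.2 h)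
    refine ⟨ψ, hψ, ?_, fun t => ?_⟩
    · rw [hr]
      congr 1
      ext x
      simp only [ne_eq, Set.mem_ofPred_eq, F.symm_apply_eq, eq_comm]
    · rw [Real.sign_of_neg (sub_neg.2 h), ← F.symm_apply_eq, ← ha, neg_add_cancel_right]
  · obtain ⟨ψ, hψ, hr, ha⟩ := F.exists_strictMono_add_one_of_lt h
    exact ⟨ψ, hψ, hr, fun t => by rw [Real.sign_of_pos (sub_pos.2 h), ha]⟩

/-- Two increasing homeomorphisms of the line with the same signature are conjugate by an
increasing homeomorphism fixing all their fixed points. -/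
theorem OrderIso.exists_conj_of_sign_eq (F G : ℝ ≃o ℝ)
    (h : ∀ x, Real.sign (F x - x) = Real.sign (G x - x)) :
    ∃ k : ℝ ≃o ℝ, (∀ x, k (F x) = G (k x)) ∧ ∀ x, F x = x → k x = x := by
  have hfix : ∀ x, F x = x ↔ G x = x := fun x => by
    rw [← sub_eq_zero, ← Real.sign_eq_zero_iff, h, Real.sign_eq_zero_iff, sub_eq_zero]
  set s : Set ℝ := {x | F x ≠ x} with hs
  have hs' : s = {x | G x ≠ x} := by ext x; exact (hfix x).not
  choose! ψ hψ hψr hψa using fun (c : ℝ) (hc : F c ≠ c) => F.exists_strictMono_add_sign hc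
  choose! χ hχ hχr hχa using
    fun (c : ℝ) (hc : F c ≠ c) => G.exists_strictMono_add_sign ((hfix c).not.1 hc)
  simp only [← hs', ← h] at hχr hχa
  obtain ⟨p, hps, hpx, hpc⟩ : ∃ p : ℝ → ℝ, (∀ x ∈ s, p x ∈ s) ∧
      (∀ x ∈ s, x ∈ s.ordConnectedComponent (p x)) ∧
      ∀ x ∈ s, ∀ y, y ∈ s.ordConnectedComponent (p x) → p y = p x := by
    refine ⟨fun x => if hx : x ∈ s then s.ordConnectedProj ⟨x, hx⟩ else x, fun x hx => ?_,
      fun x hx => ?_, fun x hx y hy => ?_⟩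
    · simp only [hx, dite_true]
      exact Set.ordConnectedComponent_subset
        (Set.ordConnectedProj_mem_ordConnectedComponent s ⟨x, hx⟩)
    · simp only [hx, dite_true]
      exact Set.mem_ordConnectedComponent_ordConnectedProj s ⟨x, hx⟩
    · have hys : y ∈ s := Set.ordConnectedComponent_subset hy
      simp only [hx, hys, dite_true] at hy ⊢
      rw [Set.ordConnectedProj_eq, Set.uIcc_comm]
      rwa [Set.ordConnectedComponent_ordConnectedProj] at hy
  obtain ⟨k, hk, hkψ⟩ : ∃ k : ℝ → ℝ, (∀ x, F x = x → k x = x) ∧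
      ∀ x ∈ s, ∀ t, k (ψ (p x) t) = χ (p x) t := by
    refine ⟨fun x => if F x = x then x else χ (p x) (Function.invFun (ψ (p x)) x),
      fun x hx => if_pos hx, fun x hx t => ?_⟩
    have hmem : ψ (p x) t ∈ s.ordConnectedComponent (p x) := by
      rw [← hψr _ (hps x hx)]; exact ⟨t, rfl⟩
    have hne : ¬ F (ψ (p x) t) = ψ (p x) t := Set.ordConnectedComponent_subset hmem
    simp only [if_neg hne, hpc x hx _ hmem]
    rw [Function.leftInverse_invFun (hψ _ (hps x hx)).injective]
  have hparam : ∀ x ∈ s, ∃ t, ψ (p x) t = x := fun x hx => by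
    have := hpx x hx
    rwa [← hψr _ (hps x hx)] at this
  have hkmem : ∀ x ∈ s, k x ∈ s.ordConnectedComponent x := fun x hx => by
    obtain ⟨t, ht⟩ := hparam x hx
    have : k x ∈ s.ordConnectedComponent (p x) := by
      rw [← hχr _ (hps x hx)]
      exact ⟨t, by rw [← hkψ x hx, ht]⟩
    exact Set.mem_ordConnectedComponent_trans
      (Set.mem_ordConnectedComponent_comm.1 (hpx x hx)) this
  have hle : ∀ x q, F q = q → x ≤ q → k x ≤ q := fun x q hq hxq => by
    by_cases hx : F x = x
    · rwa [hk x hx]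
    · by_contra! hlt
      exact hkmem x hx (Set.Icc_subset_uIcc ⟨hxq, hlt.le⟩) hq
  have hge : ∀ x q, F q = q → q ≤ x → q ≤ k x := fun x q hq hxq => by
    by_cases hx : F x = x
    · rwa [hk x hx]
    · by_contra! hlt
      exact hkmem x hx (Set.Icc_subset_uIcc' ⟨hlt.le, hxq⟩) hq
  have hkfix : ∀ x, F (k x) = k x → F x = x := fun x hx => by
    by_contra hne
    exact hkmem x hne Set.right_mem_uIcc hx
  have hmono : StrictMono k := by
    intro x y hxy
    by_cases hq : ∃ q ∈ Set.Icc x y, F q = q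
    · obtain ⟨q, ⟨hxq, hqy⟩, hq⟩ := hq
      refine ((hle x q hq hxq).trans (hge y q hq hqy)).lt_of_ne fun heq => ?_
      have hkx : k x = q := le_antisymm (hle x q hq hxq) (heq ▸ hge y q hq hqy)
      have hky : k y = q := heq ▸ hkx
      have hx := hk x (hkfix x (by rwa [hkx]))
      have hy := hk y (hkfix y (by rwa [hky]))
      linarith
    · push Not at hq
      have hxs : x ∈ s := hq x ⟨le_rfl, hxy.le⟩
      have hys : y ∈ s.ordConnectedComponent (p x) :=
        Set.mem_ordConnectedComponent_trans (hpx x hxs)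
          (by rw [Set.mem_ordConnectedComponent, Set.uIcc_of_le hxy.le]; exact hq)
      obtain ⟨t, ht⟩ := hparam x hxs
      obtain ⟨u, hu⟩ : ∃ u, ψ (p x) u = y := by rwa [← hψr _ (hps x hxs)] at hys
      have htu : t < u := (hψ _ (hps x hxs)).lt_iff_lt.1 (by rwa [ht, hu])
      have := hχ _ (hps x hxs) htu
      rwa [← hkψ x hxs, ← hkψ x hxs, ht, hu] at this
  have hsurj : Function.Surjective k := by
    intro y
    by_cases hy : F y = y
    · exact ⟨y, hk y hy⟩
    · have := hpx y hy
      rw [← hχr _ (hps y hy)] at this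
      obtain ⟨t, ht⟩ := this
      exact ⟨ψ (p y) t, by rw [hkψ y hy, ht]⟩
  refine ⟨StrictMono.orderIsoOfSurjective k hmono hsurj, fun x => ?_, hk⟩
  change k (F x) = G (k x)
  by_cases hx : F x = x
  · rw [hx, hk x hx, (hfix x).1 hx]
  · obtain ⟨t, ht⟩ := hparam x hx
    have hkx : k x = χ (p x) t := by rw [← hkψ x hx, ht]
    rw [hkx, ← hχa _ (hps x hx), ← hkψ x hx, hψa _ (hps x hx), ht]

/-- An increasing homeomorphism from `[a, b]` to `[b, a + 1]` extends to a square root of the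
unit translation. -/
theorem OrderIso.exists_sq_eq_add_one (φ : ℝ ≃o ℝ) {a b : ℝ} (hab : a < b) (ha : φ a = b)
    (hb : φ b = a + 1) :
    ∃ S : ℝ ≃o ℝ, (∀ x, S (S x) = x + 1) ∧ ∀ x ∈ Set.Ico a b, S x = φ x := by
  have hba : b < a + 1 := by rw [← hb, ← ha]; exact φ.strictMono (ha ▸ hab)
  set g : ℝ → ℝ := fun x => if x < b then φ x else φ.symm x + 1 with hg
  have hsa : φ.symm b = a := φ.symm_apply_eq.2 ha.symm
  have hsb : φ.symm (a + 1) = b := φ.symm_apply_eq.2 hb.symm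
  have hgmem : ∀ x ∈ Set.Ico a (a + 1), g x ∈ Set.Ico b (b + 1) := by
    rintro x ⟨h1, h2⟩
    by_cases hx : x < b
    · simp only [hg, if_pos hx]
      exact ⟨ha ▸ φ.monotone h1, (φ.strictMono hx).trans (by rw [hb]; linarith)⟩
    · simp only [hg, if_neg hx]
      have h3 := φ.symm.monotone (not_lt.1 hx)
      have h4 := φ.symm.strictMono h2
      rw [hsa] at h3
      rw [hsb] at h4
      exact ⟨by linarith, by linarith⟩
  have hgmono : StrictMonoOn g (Set.Ico a (a + 1)) := by
    rintro x ⟨hx1, hx2⟩ y ⟨hy1, hy2⟩ hxy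
    by_cases hy : y < b
    · simp only [hg, if_pos hy, if_pos (hxy.trans hy)]
      exact φ.strictMono hxy
    · by_cases hx : x < b
      · simp only [hg, if_neg hy, if_pos hx]
        have h3 := φ.symm.monotone (not_lt.1 hy)
        have h4 := φ.strictMono hx
        rw [hsa] at h3
        rw [hb] at h4
        linarith
      · simp only [hg, if_neg hy, if_neg hx]
        linarith [φ.symm.strictMono hxy]
  set S : ℝ → ℝ := fun x => g (x - ⌊x - a⌋) + ⌊x - a⌋ with hS
  have hred : ∀ x : ℝ, x - ⌊x - a⌋ ∈ Set.Ico a (a + 1) := fun x =>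
    ⟨by linarith [Int.floor_le (x - a)], by linarith [Int.lt_floor_add_one (x - a)]⟩
  have hSint : ∀ (x : ℝ) (n : ℤ), S (x + n) = S x + n := fun x n => by
    simp only [hS]
    rw [show x + n - a = x - a + n by ring, Int.floor_add_intCast]
    push_cast
    rw [add_sub_add_right_eq_sub, add_assoc]
  have hSone : ∀ x : ℝ, S (x + 1) = S x + 1 := fun x => by exact_mod_cast hSint x 1
  have hSg : ∀ x ∈ Set.Ico a (a + 1), S x = g x := fun x hx => by
    have : ⌊x - a⌋ = 0 := Int.floor_eq_zero_iff.2 ⟨by linarith [hx.1], by linarith [hx.2]⟩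
    simp [hS, this]
  have hSφ : ∀ x ∈ Set.Ico a b, S x = φ x := fun x hx => by
    rw [hSg x ⟨hx.1, hx.2.trans hba⟩]
    exact if_pos hx.2
  have hmono : StrictMono S := by
    intro x y hxy
    rcases (Int.floor_mono (sub_le_sub_right hxy.le a)).eq_or_lt with h | h
    · have := hgmono (hred x) (hred y) (by rw [h]; linarith)
      simp only [hS]
      rw [h] at this ⊢
      linarith
    · have h1 := (hgmem _ (hred x)).2
      have h2 := (hgmem _ (hred y)).1
      have h3 : (⌊x - a⌋ : ℝ) + 1 ≤ ⌊y - a⌋ := by exact_mod_cast h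
      simp only [hS]
      linarith
  have hSS : ∀ x, S (S x) = x + 1 := by
    have key : ∀ x ∈ Set.Ico a (a + 1), S (S x) = x + 1 := by
      rintro x ⟨h1, h2⟩
      by_cases hx : x < b
      · have h3 := φ.monotone h1
        have h4 := φ.strictMono hx
        rw [ha] at h3
        rw [hb] at h4
        rw [hSφ x ⟨h1, hx⟩, hSg _ ⟨hab.le.trans h3, h4⟩]
        simp [hg, not_lt.2 h3]
      · have h3 := φ.symm.monotone (not_lt.1 hx)
        have h4 := φ.symm.strictMono h2
        rw [hsa] at h3
        rw [hsb] at h4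
        rw [hSg x ⟨h1, h2⟩]
        simp only [hg, if_neg hx]
        rw [hSone, hSφ _ ⟨h3, h4⟩, φ.apply_symm_apply]
    intro x
    have := key _ (hred x)
    calc S (S x) = S (S (x - ⌊x - a⌋ + ⌊x - a⌋)) := by rw [sub_add_cancel]
      _ = x + 1 := by rw [hSint (x - ⌊x - a⌋), hSint (S _), this]; ring
  have hsurj : Function.Surjective S := fun y =>
    ⟨S (y - 1), by rw [hSS, sub_add_cancel]⟩
  exact ⟨StrictMono.orderIsoOfSurjective S hmono hsurj, hSS, hSφ⟩

theorem OrderIso.apply_add_intCast {S : ℝ ≃o ℝ} (hS : ∀ x, S (x + 1) = S x + 1) (x : ℝ) (n : ℤ) :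
    S (x + n) = S x + n :=
  CircleDeg1Lift.map_add_int ⟨⟨S, S.monotone⟩, hS⟩ x n

theorem OrderIso.apply_add_one_of_sq {S : ℝ ≃o ℝ} (hS : ∀ x, S (S x) = x + 1) (x : ℝ) :
    S (x + 1) = S x + 1 := by
  rw [← hS, hS]

/-- The translates of `[a, S a)` and of its image cover the line when `S ∘ S` is the unit
translation. -/
theorem OrderIso.exists_eq_add_intCast_of_sq {S : ℝ ≃o ℝ} (hS : ∀ x, S (S x) = x + 1) (a x : ℝ) :
    ∃ z ∈ Set.Ico a (S a), ∃ n : ℤ, x = z + n ∨ x = S z + n := by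
  set y := x - ⌊x - a⌋ with hy
  have h1 : a ≤ y := by linarith [Int.floor_le (x - a)]
  have h2 : y < a + 1 := by linarith [Int.lt_floor_add_one (x - a)]
  rcases lt_or_ge y (S a) with h | h
  · exact ⟨y, ⟨h1, h⟩, ⌊x - a⌋, Or.inl (by simp [hy])⟩
  · refine ⟨S.symm y, ⟨S.le_symm_apply.2 h, S.symm_apply_lt.2 (by rwa [hS])⟩, ⌊x - a⌋,
      Or.inr (by simp [hy])⟩

/-- A lift with a fixed point is reversed by a square root of the unit translation if its
signature is reversed by some lift whose square coincides somewhere with the unit translation. -/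
theorem OrderIso.exists_reversing_of_sign_eq_neg {F H : ℝ ≃o ℝ} (hF : ∀ x, F (x + 1) = F x + 1)
    {p : ℝ} (hp : F p = p) {a : ℝ} (ha : H (H a) = a + 1)
    (hsign : ∀ x, Real.sign (F x - x) = -Real.sign (F (H x) - H x)) :
    ∃ S : ℝ ≃o ℝ, (∀ x, S (S x) = x + 1) ∧ ∀ x, F (S (F x)) = S x := by
  have haH : a < H a := by
    by_contra! h
    linarith [H.monotone h]
  obtain ⟨R, hRR, hRH⟩ := H.exists_sq_eq_add_one haH rfl ha
  have hRa : R a = H a := hRH a ⟨le_rfl, haH⟩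
  have hper : ∀ (x : ℝ) (n : ℤ), F (x + n) - (x + n) = F x - x := fun x n => by
    rw [apply_add_intCast hF]; ring
  have hper1 : ∀ x, F (x + 1) - (x + 1) = F x - x := fun x => by exact_mod_cast hper x 1
  have hRint := apply_add_intCast (apply_add_one_of_sq hRR)
  have hR : ∀ x, Real.sign (F x - x) = -Real.sign (F (R x) - R x) := by
    intro x
    obtain ⟨z, hz, n, rfl | rfl⟩ := exists_eq_add_intCast_of_sq hRR a x <;> rw [hRa] at hz
    · rw [hRint, hper, hper, hRH z hz, hsign]
    · rw [hRint, hper, hper, hRR, hper1, hRH z hz, hsign z, neg_neg]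
  have hconj : ∀ x, Real.sign (F x - x) = Real.sign ((R.symm (F.symm (R x))) - x) := by
    intro x
    rw [hR]
    rcases lt_trichotomy (F (R x)) (R x) with h | h | h
    · rw [Real.sign_of_neg (sub_neg.2 h), Real.sign_of_pos, neg_neg]
      rwa [sub_pos, R.lt_symm_apply, F.lt_symm_apply]
    · have h' : F.symm (R x) = R x := F.symm_apply_eq.2 h.symm
      simp [h, h']
    · rw [Real.sign_of_pos (sub_pos.2 h), Real.sign_of_neg]
      rwa [sub_neg, R.symm_apply_lt, F.symm_apply_lt]
  obtain ⟨k, hk, hkfix⟩ := F.exists_conj_of_sign_eq ((R.trans F.symm).trans R.symm) hconj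
  have hFRp : F (R p) = R p := by
    have := hR p
    rw [hp, sub_self, Real.sign_zero, eq_comm, neg_eq_zero, Real.sign_eq_zero_iff] at this
    linarith
  have hpR : p < R p := by
    by_contra! h
    linarith [R.monotone h, hRR p]
  have hkp : R (k p) = R p := by rw [hkfix p hp]
  obtain ⟨S, hSS, hSk⟩ := (k.trans R).exists_sq_eq_add_one hpR hkp
    (by change R (k (R p)) = _; rw [hkfix _ hFRp, hRR])
  have hSp : S p = R p := (hSk p ⟨le_rfl, hpR⟩).trans hkp
  have hSone := apply_add_one_of_sq hSS
  have hSint := apply_add_intCast hSone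
  have hFint := apply_add_intCast hF
  have hbase : ∀ x ∈ Set.Ico p (R p), F (S (F x)) = S x := by
    rintro x ⟨h1, h2⟩
    have hFx : F x ∈ Set.Ico p (R p) :=
      ⟨hp ▸ F.monotone h1, by rw [← hFRp]; exact F.strictMono h2⟩
    rw [hSk x ⟨h1, h2⟩, hSk _ hFx]
    change F (R (k (F x))) = R (k x)
    rw [hk]
    change F (R (R.symm (F.symm (R (k x))))) = _
    simp
  refine ⟨S, hSS, fun x => ?_⟩
  obtain ⟨z, hz, n, rfl | rfl⟩ := exists_eq_add_intCast_of_sq hSS p x <;> rw [hSp] at hz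
  · rw [hFint, hSint, hFint, hSint, hbase z hz]
  · have hw : F.symm z ∈ Set.Ico p (R p) :=
      ⟨F.le_symm_apply.2 (by rw [hp]; exact hz.1), F.symm_apply_lt.2 (by rw [hFRp]; exact hz.2)⟩
    have := hbase _ hw
    rw [F.apply_symm_apply] at this
    rw [hFint, hSint, hFint, hSint, this, hSS, hSS, hF, F.apply_symm_apply]

theorem OrderIso.sign_eq_neg_of_reversing {F S : ℝ ≃o ℝ} (h : ∀ x, F (S (F x)) = S x) (x : ℝ) :
    Real.sign (F x - x) = -Real.sign (F (S x) - S x) := by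
  rcases lt_trichotomy (F x) x with hx | hx | hx
  · rw [Real.sign_of_neg (sub_neg.2 hx), Real.sign_of_pos]
    rw [sub_pos, ← h x, F.lt_iff_lt, h x]
    exact S.strictMono hx
  · have := h x
    rw [hx] at this
    simp [hx, this]
  · rw [Real.sign_of_pos (sub_pos.2 hx), Real.sign_of_neg, neg_neg]
    rw [sub_neg, ← h x, F.lt_iff_lt, h x]
    exact S.strictMono hx

theorem S1.coe_eq_coe_iff {x y : ℝ} : (x : S1) = (y : S1) ↔ ∃ n : ℤ, x = y + n := by
  rw [← sub_eq_zero, ← AddCircle.coe_sub, AddCircle.coe_eq_zero_iff]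
  simp only [zsmul_eq_mul, mul_one]
  exact exists_congr fun n => by rw [eq_comm, sub_eq_iff_eq_add']

theorem S1.coe_add_intCast (x : ℝ) (n : ℤ) : ((x + n : ℝ) : S1) = x :=
  S1.coe_eq_coe_iff.2 ⟨n, rfl⟩

/-- The rotation by an integer number of turns of a lift. -/
def CircleDeg1Lift.addInt (F : CircleDeg1Lift) (n : ℤ) : CircleDeg1Lift :=
  ⟨⟨fun x => F x + n, fun _ _ h => add_le_add_left (F.monotone h) _⟩, fun x => by
    simp [add_right_comm]⟩

/-- A lift of a homeomorphism is an order isomorphism. -/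
theorem IsLiftOf.exists_orderIso {f : S1 ≃ₜ S1} {F : CircleDeg1Lift} (hF : IsLiftOf f F) :
    ∃ e : ℝ ≃o ℝ, ∀ x, e x = F x := by
  have hinj : Function.Injective F := by
    intro x y hxy
    have h : (x : S1) = y := f.injective (by rw [hF, hF, hxy])
    obtain ⟨n, rfl⟩ := S1.coe_eq_coe_iff.1 h
    rw [F.map_add_int] at hxy
    linarith
  have hsurj : Function.Surjective F := by
    intro y
    obtain ⟨x, hx⟩ := QuotientAddGroup.mk_surjective (f.symm y)
    have h : ((F x : ℝ) : S1) = y := by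
      rw [← hF]
      exact f.eq_symm_apply.1 hx
    obtain ⟨n, hn⟩ := S1.coe_eq_coe_iff.1 h
    exact ⟨x - n, by rw [F.map_sub_int, hn, add_sub_cancel_right]⟩
  exact ⟨StrictMono.orderIsoOfSurjective F (F.monotone.strictMono_of_injective hinj) hsurj,
    fun _ => rfl⟩

/-- An increasing homeomorphism of the line commuting with the unit translation descends to the
circle. -/
theorem OrderIso.exists_isLiftOf (S : ℝ ≃o ℝ) (hS : ∀ x, S (x + 1) = S x + 1) :
    ∃ σ : S1 ≃ₜ S1, IsLiftOf σ ⟨⟨S, S.monotone⟩, hS⟩ := by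
  have hS' : ∀ x, S.symm (x + 1) = S.symm x + 1 := fun x => by
    rw [S.symm_apply_eq, hS, S.apply_symm_apply]
  have hper : ∀ T : ℝ ≃o ℝ, (∀ x, T (x + 1) = T x + 1) →
      Function.Periodic (fun x => ((T x : ℝ) : S1)) 1 := fun T hT x => by
    simp only [hT]
    exact_mod_cast S1.coe_add_intCast (T x) 1
  have hcont : ∀ (T : ℝ ≃o ℝ) (hT : ∀ x, T (x + 1) = T x + 1), Continuous (hper T hT).lift :=
    fun T hT => continuous_coinduced_dom.2 ((AddCircle.continuous_mk' 1).comp T.continuous)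
  refine ⟨⟨⟨(hper S hS).lift, (hper S.symm hS').lift, fun x => ?_, fun x => ?_⟩,
    hcont S hS, hcont S.symm hS'⟩, fun x => rfl⟩
  · induction x using QuotientAddGroup.induction_on with
    | H x => exact congrArg _ (S.symm_apply_apply x)
  · induction x using QuotientAddGroup.induction_on with
    | H x => exact congrArg _ (S.apply_symm_apply x)

theorem signature_coe (F : CircleDeg1Lift) (x : ℝ) :
    signature F (x : S1) = Real.sign (F x - x) := by
  obtain ⟨n, hn⟩ := S1.coe_eq_coe_iff.1 (AddCircle.coe_equivIco (p := 1) (a := 0) (y := (x : S1)))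
  change Real.sign (F (AddCircle.equivIco 1 0 (x : S1)) - (AddCircle.equivIco 1 0 (x : S1))) = _
  rw [hn, F.map_add_int, add_sub_add_right_eq_sub]

/-- A lift of the identity is a translation by an integer. -/
theorem OrderIso.exists_eq_add_intCast {K : ℝ ≃o ℝ} (hK : ∀ x, K (x + 1) = K x + 1)
    (h : ∀ x : ℝ, ((K x : ℝ) : S1) = x) : ∃ n : ℤ, ∀ x, K x = x + n := by
  choose m hm using fun x => S1.coe_eq_coe_iff.1 (h x)
  have hunit : ∀ x ∈ Set.Ico (0 : ℝ) 1, K x = x + m 0 := by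
    rintro x ⟨h0, h1⟩
    have h2 : K 0 ≤ K x := K.monotone h0
    have h3 : K x < K (0 + 1) := K.strictMono (by rwa [zero_add])
    rw [hK] at h3
    rw [hm x, hm 0] at h2 h3
    have h4 : (m 0 : ℝ) < m x + 1 := by linarith
    have h5 : (m x : ℝ) < m 0 + 1 := by linarith
    norm_cast at h4 h5
    rw [hm x, show m x = m 0 by lia]
  refine ⟨m 0, fun x => ?_⟩
  rw [← Int.fract_add_floor x, apply_add_intCast hK,
    hunit _ ⟨Int.fract_nonneg x, Int.fract_lt_one x⟩]
  ring

/-- The half turn. -/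
theorem exists_hasRotationNumber_half :
    ∃ h : S1 ≃ₜ S1, OrientationPreserving h ∧ HasRotationNumber h (1 / 2) := by
  obtain ⟨h, hh⟩ := (OrderIso.addRight (1 / 2 : ℝ)).exists_isLiftOf
    (fun x => by simp [add_right_comm])
  refine ⟨h, ⟨_, hh⟩, _, hh, ?_⟩
  have := CircleDeg1Lift.translationNumber_of_map_pow_eq_add_int
    (f := ⟨⟨OrderIso.addRight (1 / 2 : ℝ), (OrderIso.addRight (1 / 2 : ℝ)).monotone⟩,
      fun x => by simp [add_right_comm]⟩) (x := 0) (n := 2) (m := 1)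
    (by simp [pow_two, CircleDeg1Lift.mul_apply]; norm_num) two_pos
  simpa using this

/-- An orientation preserving involution other than the identity has a lift whose square is the
unit translation. -/
theorem IsInvolution.eq_id_or_exists_isLiftOf {σ : S1 ≃ₜ S1} (hσ : OrientationPreserving σ)
    (hinv : IsInvolution σ) :
    (∀ x, σ x = x) ∨ ∃ S : CircleDeg1Lift, IsLiftOf σ S ∧ ∀ x, S (S x) = x + 1 := by
  obtain ⟨S, hS⟩ := hσ
  obtain ⟨e, he⟩ := hS.exists_orderIso
  obtain ⟨n, hn⟩ := OrderIso.exists_eq_add_intCast (K := e.trans e)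
    (fun x => by simp [he]) (fun x => by
      change ((e (e x) : ℝ) : S1) = x
      rw [he, he, ← hS, ← hS, hinv])
  replace hn : ∀ x, S (S x) = x + n := fun x => by rw [← he, ← he]; exact hn x
  have hlift : ∀ m : ℤ, IsLiftOf σ (S.addInt m) := fun m x => by
    rw [hS]
    exact (S1.coe_add_intCast _ m).symm
  have hsq : ∀ (m : ℤ) (x : ℝ), S.addInt m (S.addInt m x) = x + (n + 2 * m) := fun m x => by
    change S (S x + m) + m = _
    rw [S.map_add_int, hn]
    ring
  rcases Int.even_or_odd' n with ⟨m, rfl | rfl⟩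
  · left
    intro x
    induction x using QuotientAddGroup.induction_on with
    | H x =>
      have h2 : ∀ y, S.addInt (-m) (S.addInt (-m) y) = y := fun y => by
        rw [hsq]; push_cast; ring
      have : S.addInt (-m) x = x := by
        rcases le_total (S.addInt (-m) x) x with h | h
        · exact h.antisymm (by simpa only [h2] using (S.addInt (-m)).monotone h)
        · exact h.antisymm' (by simpa only [h2] using (S.addInt (-m)).monotone h)
      exact (hlift (-m) x).trans (by rw [this])
  · exact Or.inr ⟨_, hlift (-m), fun x => by rw [hsq]; push_cast; ring⟩

/-- An orientation preserving circle homeomorphism `f` with a fixed point (with lift `F`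
fixing a point, so that `signature F = Δ_f`) is strongly reversible in `Homeo⁺(S¹)` iff
there is an orientation preserving `h` of rotation number `1/2` with `Δ_f = -Δ_f ∘ h`. -/
theorem stmt11 (f : S1 ≃ₜ S1) (hf : OrientationPreserving f)
    (F : CircleDeg1Lift) (hF : IsLiftOf f F) (hFfix : ∃ x : ℝ, F x = x) :
    StronglyReversiblePlus f ↔
      ∃ h : S1 ≃ₜ S1, OrientationPreserving h ∧ HasRotationNumber h (1 / 2) ∧
        ∀ y : S1, signature F y = -signature F (h y) := by
  obtain ⟨p, hp⟩ := hFfix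
  obtain ⟨E, hE⟩ := hF.exists_orderIso
  have hE1 : ∀ x, E (x + 1) = E x + 1 := fun x => by simp [hE]
  constructor
  · rintro ⟨σ, hσ, hinv, hrev⟩
    rcases hinv.eq_id_or_exists_isLiftOf hσ with hid | ⟨S, hS, hSS⟩
    · obtain ⟨h, hh, hr⟩ := exists_hasRotationNumber_half
      refine ⟨h, hh, hr, ?_⟩
      obtain ⟨n, hn⟩ := OrderIso.exists_eq_add_intCast (K := E.trans E)
        (fun x => by simp [hE]) (fun x => by
          change ((E (E x) : ℝ) : S1) = x
          rw [hE, hE, ← hF, ← hF]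
          have := hrev x
          rw [hid, hid] at this
          rw [this, f.apply_symm_apply])
      replace hn : ∀ x, F (F x) = x + n := fun x => by rw [← hE, ← hE]; exact hn x
      have hn0 : (n : ℝ) = 0 := by
        have := hn p
        rw [hp, hp] at this
        linarith
      simp only [hn0, add_zero] at hn
      have hFid : ∀ x, F x = x := fun x => by
        rcases le_total (F x) x with h | h
        · exact h.antisymm (by simpa only [hn] using F.monotone h)
        · exact h.antisymm' (by simpa only [hn] using F.monotone h)
      simp [signature, hFid]
    · refine ⟨σ, hσ, ⟨S, hS, ?_⟩, ?_⟩
      · have := CircleDeg1Lift.translationNumber_of_map_pow_eq_add_int S (x := 0) (n := 2) (m := 1)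
          (by simp [pow_two, CircleDeg1Lift.mul_apply, hSS]) two_pos
        simpa using this
      · obtain ⟨e, he⟩ := hS.exists_orderIso
        obtain ⟨n, hn⟩ := OrderIso.exists_eq_add_intCast (K := ((e.trans E).trans e).trans E)
          (fun x => by simp [hE, he]) (fun x => by
            change ((E (e (E (e x))) : ℝ) : S1) = x
            rw [hE, he, hE, he, ← hF, ← hS, ← hF, ← hS, hrev, f.apply_symm_apply])
        replace hn : ∀ x, E (e (E (e x))) = x + n := hn
        have hee : ∀ x, e (e x) = x + 1 := fun x => by rw [he, he, hSS]
        have hn1 : F (e.symm p) = e.symm p + ((n - 1 : ℤ) : ℝ) := by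
          have h1 := hn (e.symm p)
          rw [e.apply_symm_apply, hE p, hp] at h1
          have h2 := hee (e.symm p)
          rw [e.apply_symm_apply] at h2
          rw [h2, hE1, hE] at h1
          push_cast
          linarith
        have hn0 := (CircleDeg1Lift.translationNumber_of_eq_add_int F hn1).symm.trans
          (CircleDeg1Lift.translationNumber_of_eq_add_int F (m := 0) (x := p) (by simp [hp]))
        have hn2 : (n : ℝ) = 1 := by
          push_cast at hn0
          linarith
        have hEe : ∀ x, E (e (E x)) = e x := fun x => by
          have := hn (e.symm x)
          rwa [hn2, ← hee, e.apply_symm_apply] at this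
        intro y
        induction y using QuotientAddGroup.induction_on with
        | H y =>
          rw [hS, signature_coe, signature_coe, ← hE, ← hE, ← he]
          exact OrderIso.sign_eq_neg_of_reversing hEe y
  · rintro ⟨h, -, ⟨H, hH, hτ⟩, hsign⟩
    obtain ⟨e, he⟩ := hH.exists_orderIso
    have hcont : Continuous H := by
      rw [show ⇑H = e from funext fun x => (he x).symm]
      exact e.continuous
    obtain ⟨a, ha⟩ := (H ^ 2).exists_eq_add_translationNumber (H.continuous_pow hcont 2)
    rw [CircleDeg1Lift.translationNumber_pow, hτ, pow_two, CircleDeg1Lift.mul_apply] at ha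
    obtain ⟨S, hSS, hSF⟩ := OrderIso.exists_reversing_of_sign_eq_neg (F := E) (H := e) hE1
      (p := p) (by rw [hE, hp]) (a := a) (by rw [he, he, ha]; norm_num) (fun x => by
        have := hsign x
        rwa [hH, signature_coe, signature_coe, ← hE, ← hE, ← he] at this)
    obtain ⟨σ, hσ⟩ := S.exists_isLiftOf (OrderIso.apply_add_one_of_sq hSS)
    replace hσ' : ∀ x : ℝ, σ x = (S x : ℝ) := hσ
    refine ⟨σ, ⟨_, hσ⟩, fun x => ?_, fun x => ?_⟩
    · induction x using QuotientAddGroup.induction_on with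
      | H x =>
        rw [hσ', hσ', hSS]
        exact_mod_cast S1.coe_add_intCast x 1
    · rw [f.eq_symm_apply]
      induction x using QuotientAddGroup.induction_on with
      | H x =>
        rw [hσ', hF, hσ', hF, ← hE, ← hE, hSF, hSS]
        exact_mod_cast S1.coe_add_intCast x 1
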